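/- Let n ≥ 1, m ≥ 3, and let B_1, …, B_m be n×n complex skew-Hermitian matrices (Bᴴ_r = −B_r). Then Σ_{r,s=1}^m ‖[B_r, B_s]‖² ≤ (4/3)(Σ_{r=1}^m ‖B_r‖²)². -/

import Mathlib

open Matrix

/-- Squared Frobenius norm of a complex matrix: `Re tr (A Aᴴ)`. -/
noncomputable def frobSq {n : ℕ} (A : Matrix (Fin n) (Fin n) ℂ) : ℝ :=
  ((A * Aᴴ).trace).re

/-- Commutator of matrices. -/
noncomputable def mcomm {n : ℕ} (A B : Matrix (Fin n) (Fin n) ℂ) : Matrix (Fin n) (Fin n) ℂ :=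
  A * B - B * A

theorem frobSq_eq_sum_normSq {n : ℕ} (A : Matrix (Fin n) (Fin n) ℂ) :
    frobSq A = ∑ i, ∑ j, Complex.normSq (A i j) := by
  simp [frobSq, Matrix.trace, Matrix.mul_apply, Complex.mul_conj]

theorem frobSq_nonneg {n : ℕ} (A : Matrix (Fin n) (Fin n) ℂ) : 0 ≤ frobSq A := by
  rw [frobSq_eq_sum_normSq]
  exact Finset.sum_nonneg fun i _ => Finset.sum_nonneg fun j _ => Complex.normSq_nonneg _

theorem normSq_apply_le_frobSq {n : ℕ} (A : Matrix (Fin n) (Fin n) ℂ) (i j : Fin n) :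
    Complex.normSq (A i j) ≤ frobSq A := by
  rw [frobSq_eq_sum_normSq]
  refine (Finset.single_le_sum (f := fun j => Complex.normSq (A i j))
    (fun j _ => Complex.normSq_nonneg _) (Finset.mem_univ j)).trans ?_
  exact Finset.single_le_sum (f := fun i => ∑ j, Complex.normSq (A i j))
    (fun i _ => Finset.sum_nonneg fun j _ => Complex.normSq_nonneg _) (Finset.mem_univ i)

theorem frobSq_mcomm_comm {n : ℕ} (A B : Matrix (Fin n) (Fin n) ℂ) :
    frobSq (mcomm A B) = frobSq (mcomm B A) := by
  have h : mcomm A B = -mcomm B A := by simp [mcomm]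
  simp [h, frobSq]

theorem frobSq_mcomm_self {n : ℕ} (A : Matrix (Fin n) (Fin n) ℂ) :
    frobSq (mcomm A A) = 0 := by
  simp [mcomm, frobSq]

/-- A Hermitian matrix is diagonalized by a unitary matrix, with real diagonal. -/
theorem Matrix.IsHermitian.exists_unitary_conj_eq_diagonal {𝕜 ι : Type*} [RCLike 𝕜] [Fintype ι]
    [DecidableEq ι] {A : Matrix ι ι 𝕜} (hA : A.IsHermitian) :
    ∃ (V : Matrix ι ι 𝕜) (l : ι → ℝ), Vᴴ * V = 1 ∧ V * Vᴴ = 1 ∧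
      Vᴴ * A * V = diagonal (fun i => (l i : 𝕜)) := by
  refine ⟨hA.eigenvectorUnitary, hA.eigenvalues, ?_, ?_, ?_⟩
  · exact Unitary.coe_star_mul_self hA.eigenvectorUnitary
  · exact Unitary.coe_mul_star_self hA.eigenvectorUnitary
  · have := hA.conjStarAlgAut_star_eigenvectorUnitary
    rw [Unitary.conjStarAlgAut_apply] at this
    simpa [Matrix.star_eq_conjTranspose, Function.comp_def] using this

/-- A family of index pairs, any two of which agree in a coordinate, is constant in one of them. -/
theorem forall_fst_eq_or_forall_snd_eq {α β : Type*} {S : Set (α × β)}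
    (h : ∀ e ∈ S, ∀ f ∈ S, e.1 = f.1 ∨ e.2 = f.2) :
    (∀ e ∈ S, ∀ f ∈ S, e.1 = f.1) ∨ (∀ e ∈ S, ∀ f ∈ S, e.2 = f.2) := by
  by_contra! hc
  obtain ⟨⟨e, he, f, hf, hef⟩, g, hg, k, hk, hgk⟩ := hc
  have := h e he f hf
  have := h g hg k hk
  have := h e he g hg
  have := h e he k hk
  have := h f hf g hg
  have := h f hf k hk
  grind

/-- A star with centre `i` and leaves `J` has largest Laplacian eigenvalue at most `#J + 1`. -/
theorem sum_sub_sq_sub_le {ι : Type*} [Fintype ι] [DecidableEq ι] (l : ι → ℝ) (i : ι)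
    (J : Finset ι) (hi : i ∉ J) :
    ∑ j ∈ J, ((l i - l j) ^ 2 - ∑ k, l k ^ 2) ≤ ∑ k, l k ^ 2 := by
  set a := ∑ k, l k ^ 2 with ha
  have h1 : l i ^ 2 + ∑ j ∈ J, l j ^ 2 ≤ a := by
    rw [← Finset.sum_insert (f := fun k => l k ^ 2) hi, ha]
    exact Finset.sum_le_univ_sum_of_nonneg fun k => sq_nonneg _
  have h2 : (∑ j ∈ J, l j) ^ 2 ≤ (J.card : ℝ) * ∑ j ∈ J, l j ^ 2 := sq_sum_le_card_mul_sum_sq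
  have h3 : ∑ j ∈ J, ((l i - l j) ^ 2 - a) =
      J.card * l i ^ 2 - 2 * l i * (∑ j ∈ J, l j) + ∑ j ∈ J, l j ^ 2 - J.card * a := by
    simp only [sub_sq, Finset.sum_sub_distrib, Finset.sum_add_distrib, ← Finset.mul_sum,
      Finset.sum_const, nsmul_eq_mul]
  have h4 : (0 : ℝ) ≤ J.card := Nat.cast_nonneg _
  rw [h3]
  nlinarith [mul_le_mul_of_nonneg_left h1 h4, sq_nonneg (l i + ∑ j ∈ J, l j)]

theorem sum_sub_sq_sub_le_of_lt {ι : Type*} [Fintype ι] [DecidableEq ι] (l : ι → ℝ) :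
    ∑ e : ι × ι with l e.2 < l e.1 ∧ ∑ k, l k ^ 2 < (l e.1 - l e.2) ^ 2,
      ((l e.1 - l e.2) ^ 2 - ∑ k, l k ^ 2) ≤ ∑ k, l k ^ 2 := by
  set a := ∑ k, l k ^ 2 with ha
  have hsub (J : Finset ι) : ∑ j ∈ J, l j ^ 2 ≤ a :=
    Finset.sum_le_univ_sum_of_nonneg fun k => sq_nonneg _
  set S : Finset (ι × ι) :=
    Finset.univ.filter fun e => l e.2 < l e.1 ∧ a < (l e.1 - l e.2) ^ 2 with hS
  have hmem : ∀ e ∈ S, l e.2 < 0 ∧ 0 < l e.1 ∧ e.1 ≠ e.2 ∧ a < (l e.1 - l e.2) ^ 2 := by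
    intro e he
    simp only [hS, Finset.mem_filter, Finset.mem_univ, true_and] at he
    have hne : e.1 ≠ e.2 := fun h => by simp [h] at he
    have := hsub {e.1, e.2}
    rw [Finset.sum_pair hne] at this
    refine ⟨?_, ?_, hne, he.2⟩ <;> by_contra! hc <;> nlinarith
  have hinter : ∀ e ∈ (S : Set (ι × ι)), ∀ f ∈ (S : Set (ι × ι)), e.1 = f.1 ∨ e.2 = f.2 := by
    intro e he f hf
    by_contra! hc
    obtain ⟨he1, he2, hne, he3⟩ := hmem e he
    obtain ⟨hf1, hf2, hnf, hf3⟩ := hmem f hf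
    have h1 : e.1 ≠ f.2 := fun h => by rw [h] at he2; linarith
    have h2 : e.2 ≠ f.1 := fun h => by rw [h] at he1; linarith
    have := hsub {e.1, e.2, f.1, f.2}
    rw [Finset.sum_insert (by simp [hne, hc.1, h1]), Finset.sum_insert (by simp [h2, hc.2]),
      Finset.sum_pair hnf] at this
    nlinarith [sq_nonneg (l e.1 + l e.2), sq_nonneg (l f.1 + l f.2)]
  rcases S.eq_empty_or_nonempty with h0 | ⟨e₀, he₀⟩
  · rw [h0, Finset.sum_empty]
    exact Finset.sum_nonneg fun k _ => sq_nonneg _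
  rcases forall_fst_eq_or_forall_snd_eq hinter with h | h
  · have hinj : Set.InjOn Prod.snd (S : Set (ι × ι)) :=
      fun e he f hf hef => Prod.ext (h e he f hf) hef
    have key := sum_sub_sq_sub_le l e₀.1 (S.image Prod.snd) (by
      rw [Finset.mem_image]
      rintro ⟨f, hf, hfe⟩
      exact (hmem f hf).2.2.1 (hfe ▸ (h f hf e₀ he₀)))
    rw [Finset.sum_image hinj] at key
    refine le_of_eq_of_le (Finset.sum_congr rfl fun e he => ?_) key
    rw [h e he e₀ he₀]
  · have hinj : Set.InjOn Prod.fst (S : Set (ι × ι)) :=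
      fun e he f hf hef => Prod.ext hef (h e he f hf)
    have key := sum_sub_sq_sub_le l e₀.2 (S.image Prod.fst) (by
      rw [Finset.mem_image]
      rintro ⟨f, hf, hfe⟩
      exact (hmem f hf).2.2.1 (hfe.trans (h e₀ he₀ f hf)))
    rw [Finset.sum_image hinj] at key
    refine le_of_eq_of_le (Finset.sum_congr rfl fun e he => ?_) key
    rw [h e he e₀ he₀]
    ring

/-- The positive parts of `(lᵢ - lⱼ)² - ∑ lₖ²` over all ordered pairs sum to at most
`2 ∑ lₖ²`. -/
theorem sum_posPart_sub_sq_sub_le {ι : Type*} [Fintype ι] [DecidableEq ι] (l : ι → ℝ) :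
    ∑ i, ∑ j, max ((l i - l j) ^ 2 - ∑ k, l k ^ 2) 0 ≤ 2 * ∑ k, l k ^ 2 := by
  have h := sum_sub_sq_sub_le_of_lt l
  set a := ∑ k, l k ^ 2 with ha
  have ha0 : 0 ≤ a := Finset.sum_nonneg fun k _ => sq_nonneg _
  rw [Finset.sum_filter, Fintype.sum_prod_type] at h
  have hsplit : ∑ i, ∑ j, max ((l i - l j) ^ 2 - a) 0 =
      (∑ i, ∑ j, if l j < l i ∧ a < (l i - l j) ^ 2 then (l i - l j) ^ 2 - a else 0) +
      ∑ i, ∑ j, if l i < l j ∧ a < (l j - l i) ^ 2 then (l j - l i) ^ 2 - a else 0 := by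
    simp only [← Finset.sum_add_distrib]
    refine Finset.sum_congr rfl fun i _ => Finset.sum_congr rfl fun j _ => ?_
    have hs : (l j - l i) ^ 2 = (l i - l j) ^ 2 := by ring
    rw [hs]
    rcases lt_trichotomy (l i) (l j) with hij | hij | hij
    · grind
    · simp [hij, ha0]
    · grind
  rw [hsplit]
  nth_rewrite 2 [Finset.sum_comm]
  linarith

/-- Bound on a weighted sum by `c` times the two largest values. -/
theorem sum_mul_le_of_two_largest {ι : Type*} [DecidableEq ι] (S : Finset ι) (u : ι)
    {a w : ι → ℝ} {c p q : ℝ} (hw0 : ∀ s, 0 ≤ w s) (hwc : ∀ s, w s ≤ c)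
    (hsum : ∑ s ∈ S, w s ≤ 2 * c) (hq : 0 ≤ q) (hqp : q ≤ p) (hu : a u ≤ p)
    (ha : ∀ s ∈ S, s ≠ u → a s ≤ q) :
    ∑ s ∈ S, a s * w s ≤ c * (p + q) := by
  have hc : 0 ≤ c := (hw0 u).trans (hwc u)
  have h1 : ∑ s ∈ S, (a s * w s - q * w s) ≤ ∑ s ∈ S, if s = u then (p - q) * c else 0 := by
    refine Finset.sum_le_sum fun s hs => ?_
    split_ifs with h
    · subst h
      nlinarith [mul_le_mul_of_nonneg_right hu (hw0 s),
        mul_le_mul_of_nonneg_left (hwc s) (sub_nonneg.2 hqp)]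
    · nlinarith [mul_le_mul_of_nonneg_right (ha s hs h) (hw0 s)]
  have h2 : (∑ s ∈ S, if s = u then (p - q) * c else 0) ≤ (p - q) * c := by
    rw [Finset.sum_ite_eq']
    split_ifs
    · exact le_rfl
    · exact mul_nonneg (sub_nonneg.2 hqp) hc
  rw [Finset.sum_sub_distrib, ← Finset.mul_sum] at h1
  nlinarith [mul_le_mul_of_nonneg_left hsum hq]

/-- Bessel's inequality for a matrix unit and a family of orthogonal matrices. -/
theorem sum_normSq_apply_div_frobSq_le_one {n : ℕ} {ι : Type*} [Fintype ι]
    (X : ι → Matrix (Fin n) (Fin n) ℂ) (hX : ∀ s t, s ≠ t → (X s * (X t)ᴴ).trace = 0)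
    (i j : Fin n) : ∑ s, Complex.normSq (X s i j) / frobSq (X s) ≤ 1 := by
  classical
  set c := ∑ s, Complex.normSq (X s i j) / frobSq (X s) with hc
  set M : Matrix (Fin n) (Fin n) ℂ :=
    ∑ s, (star (X s i j) / (frobSq (X s) : ℂ)) • X s with hM
  have hMij : M i j = (c : ℂ) := by
    simp only [hM, hc, Matrix.sum_apply, Matrix.smul_apply, smul_eq_mul, Complex.ofReal_sum,
      Complex.ofReal_div, Complex.normSq_eq_conj_mul_self, starRingEnd_apply]
    exact Finset.sum_congr rfl fun s _ => by ring
  have hMM : frobSq M = c := by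
    have hre (s : ι) : (star (X s i j) / (frobSq (X s) : ℂ) *
        (star (star (X s i j) / (frobSq (X s) : ℂ)) * (X s * (X s)ᴴ).trace)).re =
        Complex.normSq (X s i j) / frobSq (X s) := by
      have : star (X s i j) / (frobSq (X s) : ℂ) * (star (star (X s i j) / (frobSq (X s) : ℂ)) *
          (X s * (X s)ᴴ).trace) =
          ((Complex.normSq (X s i j) / frobSq (X s) ^ 2 : ℝ) : ℂ) * (X s * (X s)ᴴ).trace := by
        rw [← mul_assoc]
        congr 1
        push_cast
        rw [Complex.normSq_eq_conj_mul_self, starRingEnd_apply, star_div₀, star_star]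
        simp only [Complex.star_def, Complex.conj_ofReal]
        rw [div_mul_div_comm, sq]
      rw [this, Complex.re_ofReal_mul]
      change _ * frobSq (X s) = _
      by_cases h0 : frobSq (X s) = 0
      · simp [h0]
      · field_simp
    rw [frobSq, hM, conjTranspose_sum, Finset.sum_mul_sum]
    simp only [conjTranspose_smul, smul_mul_smul_comm, trace_sum, trace_smul, smul_eq_mul,
      Complex.re_sum, mul_assoc]
    rw [hc]
    refine Finset.sum_congr rfl fun s _ => ?_
    rw [Finset.sum_eq_single s (fun t _ hts => by simp [hX s t hts.symm]) (by simp)]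
    exact hre s
  have := normSq_apply_le_frobSq M i j
  rw [hMij, hMM, Complex.normSq_ofReal] at this
  by_contra! h
  nlinarith

theorem frobSq_diagonal {n : ℕ} (l : Fin n → ℝ) :
    frobSq (diagonal fun i => (l i : ℂ) * Complex.I) = ∑ i, l i ^ 2 := by
  simp only [frobSq, diagonal_conjTranspose, diagonal_mul_diagonal, trace_diagonal, Complex.re_sum]
  refine Finset.sum_congr rfl fun i _ => ?_
  simp [sq]

theorem frobSq_mcomm_diagonal {n : ℕ} (l : Fin n → ℝ) (X : Matrix (Fin n) (Fin n) ℂ) :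
    frobSq (mcomm (diagonal fun i => (l i : ℂ) * Complex.I) X) =
      ∑ i, ∑ j, (l i - l j) ^ 2 * Complex.normSq (X i j) := by
  rw [frobSq_eq_sum_normSq]
  refine Finset.sum_congr rfl fun i _ => Finset.sum_congr rfl fun j _ => ?_
  have : mcomm (diagonal fun i => (l i : ℂ) * Complex.I) X i j =
      ((l i - l j : ℝ) : ℂ) * Complex.I * X i j := by
    simp only [mcomm, Matrix.sub_apply, diagonal_mul, mul_diagonal]
    push_cast
    ring
  rw [this, map_mul, map_mul, Complex.normSq_ofReal, Complex.normSq_I]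
  ring

theorem sum_frobSq_mcomm_le_of_diagonal {n : ℕ} {ι : Type*} [Fintype ι] [DecidableEq ι]
    (X : ι → Matrix (Fin n) (Fin n) ℂ) (hX : ∀ s t, s ≠ t → (X s * (X t)ᴴ).trace = 0)
    {r u : ι} {l : Fin n → ℝ} (hr : X r = diagonal fun i => (l i : ℂ) * Complex.I)
    {p q : ℝ} (hq : 0 ≤ q) (hqp : q ≤ p) (hu : frobSq (X u) ≤ p)
    (ha : ∀ s, s ≠ r → s ≠ u → frobSq (X s) ≤ q) :
    ∑ s, frobSq (mcomm (X r) (X s)) ≤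
      frobSq (X r) * (∑ s, frobSq (X s) - frobSq (X r) + p + q) := by
  set c := ∑ i, l i ^ 2 with hc
  have hrc : frobSq (X r) = c := by rw [hr, frobSq_diagonal]
  have hc0 : 0 ≤ c := hrc ▸ frobSq_nonneg _
  let d : Fin n → Fin n → ℝ := fun i j => max ((l i - l j) ^ 2 - c) 0
  have hd0 (i j) : 0 ≤ d i j := le_max_right _ _
  have hdc (i j) : d i j ≤ c := by
    refine max_le ?_ hc0
    have hij : (l i - l j) ^ 2 ≤ 2 * c := by
      by_cases h : i = j
      · simp [h, hc0]
      · have := Finset.sum_le_univ_sum_of_nonneg (s := {i, j}) fun k => sq_nonneg (l k)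
        rw [Finset.sum_pair h] at this
        nlinarith [sq_nonneg (l i + l j)]
    linarith
  let w : ι → ℝ := fun s => ∑ i, ∑ j, d i j * (Complex.normSq (X s i j) / frobSq (X s))
  have hfrac (s : ι) (i j : Fin n) : 0 ≤ Complex.normSq (X s i j) / frobSq (X s) :=
    div_nonneg (Complex.normSq_nonneg _) (frobSq_nonneg _)
  have hw0 (s) : 0 ≤ w s :=
    Finset.sum_nonneg fun i _ => Finset.sum_nonneg fun j _ => mul_nonneg (hd0 i j) (hfrac s i j)
  have hwc (s) : w s ≤ c := by
    calc w s ≤ ∑ i, ∑ j, c * (Complex.normSq (X s i j) / frobSq (X s)) :=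
          Finset.sum_le_sum fun i _ => Finset.sum_le_sum fun j _ =>
            mul_le_mul_of_nonneg_right (hdc i j) (hfrac s i j)
      _ = c * (frobSq (X s) / frobSq (X s)) := by
          simp only [← Finset.mul_sum, ← Finset.sum_div, ← frobSq_eq_sum_normSq]
      _ ≤ c := mul_le_of_le_one_right hc0 (div_self_le_one _)
  have hsum : ∑ s ∈ Finset.univ.erase r, w s ≤ 2 * c := by
    calc ∑ s ∈ Finset.univ.erase r, w s ≤ ∑ s, w s :=
          Finset.sum_le_univ_sum_of_nonneg hw0
      _ = ∑ i, ∑ j, d i j * ∑ s, Complex.normSq (X s i j) / frobSq (X s) := by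
          simp only [w, Finset.mul_sum]
          rw [Finset.sum_comm]
          exact Finset.sum_congr rfl fun i _ => Finset.sum_comm
      _ ≤ ∑ i, ∑ j, d i j :=
          Finset.sum_le_sum fun i _ => Finset.sum_le_sum fun j _ =>
            mul_le_of_le_one_right (hd0 i j) (sum_normSq_apply_div_frobSq_le_one X hX i j)
      _ ≤ 2 * c := sum_posPart_sub_sq_sub_le l
  have hterm (s) : frobSq (mcomm (X r) (X s)) ≤ c * frobSq (X s) + frobSq (X s) * w s := by
    rw [hr, frobSq_mcomm_diagonal]
    have hfr (i j) : frobSq (X s) * (Complex.normSq (X s i j) / frobSq (X s)) =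
        Complex.normSq (X s i j) := by
      by_cases h0 : frobSq (X s) = 0
      · have := normSq_apply_le_frobSq (X s) i j
        have := Complex.normSq_nonneg (X s i j)
        rw [h0, zero_mul]
        linarith
      · exact mul_div_cancel₀ _ h0
    have hw : frobSq (X s) * w s = ∑ i, ∑ j, d i j * Complex.normSq (X s i j) := by
      simp only [w, Finset.mul_sum, mul_left_comm (frobSq (X s)), hfr]
    rw [hw]
    nth_rewrite 1 [frobSq_eq_sum_normSq]
    simp only [Finset.mul_sum, ← Finset.sum_add_distrib, ← add_mul]
    refine Finset.sum_le_sum fun i _ => Finset.sum_le_sum fun j _ =>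
      mul_le_mul_of_nonneg_right ?_ (Complex.normSq_nonneg _)
    have : (l i - l j) ^ 2 - c ≤ d i j := le_max_left _ _
    linarith
  have key := sum_mul_le_of_two_largest (a := fun s => frobSq (X s)) (Finset.univ.erase r) u
    hw0 hwc hsum hq hqp hu fun s hs hsu => ha s (Finset.ne_of_mem_erase hs) hsu
  rw [← Finset.add_sum_erase _ _ (Finset.mem_univ r), frobSq_mcomm_self, zero_add,
    ← Finset.add_sum_erase (a := r) _ (fun s => frobSq (X s)) (Finset.mem_univ r), hrc]
  calc _ ≤ ∑ s ∈ Finset.univ.erase r, (c * frobSq (X s) + frobSq (X s) * w s) :=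
        Finset.sum_le_sum fun s _ => hterm s
    _ ≤ _ := by
        rw [Finset.sum_add_distrib, ← Finset.mul_sum]
        linarith

theorem trace_unitary_conj_mul {n : ℕ} {V : Matrix (Fin n) (Fin n) ℂ} (hV : V * Vᴴ = 1)
    (A B : Matrix (Fin n) (Fin n) ℂ) :
    ((Vᴴ * A * V) * (Vᴴ * B * V)ᴴ).trace = (A * Bᴴ).trace := by
  have : (Vᴴ * A * V) * (Vᴴ * B * V)ᴴ = Vᴴ * (A * (V * Vᴴ) * Bᴴ) * V := by
    simp only [conjTranspose_mul, conjTranspose_conjTranspose, Matrix.mul_assoc]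
  rw [this, hV, trace_mul_comm, ← Matrix.mul_assoc, hV, Matrix.mul_one, Matrix.one_mul]

theorem frobSq_unitary_conj {n : ℕ} {V : Matrix (Fin n) (Fin n) ℂ} (hV : V * Vᴴ = 1)
    (A : Matrix (Fin n) (Fin n) ℂ) : frobSq (Vᴴ * A * V) = frobSq A := by
  rw [frobSq, trace_unitary_conj_mul hV, frobSq]

theorem mcomm_unitary_conj {n : ℕ} {V : Matrix (Fin n) (Fin n) ℂ} (hV : V * Vᴴ = 1)
    (A B : Matrix (Fin n) (Fin n) ℂ) :
    mcomm (Vᴴ * A * V) (Vᴴ * B * V) = Vᴴ * mcomm A B * V := by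
  have (A B : Matrix (Fin n) (Fin n) ℂ) :
      (Vᴴ * A * V) * (Vᴴ * B * V) = Vᴴ * (A * B) * V := by
    calc _ = Vᴴ * A * (V * Vᴴ) * B * V := by simp only [Matrix.mul_assoc]
      _ = _ := by rw [hV]; simp only [Matrix.mul_assoc, Matrix.one_mul]
  simp only [mcomm, this, Matrix.mul_sub, Matrix.sub_mul]

/-- For an orthogonal family, the commutators with a skew-Hermitian member `X r` are controlled by
the two largest squared norms of the other members. -/
theorem sum_frobSq_mcomm_le {n : ℕ} {ι : Type*} [Fintype ι] [DecidableEq ι]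
    (X : ι → Matrix (Fin n) (Fin n) ℂ) (hX : ∀ s t, s ≠ t → (X s * (X t)ᴴ).trace = 0)
    {r u : ι} (hr : (X r)ᴴ = -X r)
    {p q : ℝ} (hq : 0 ≤ q) (hqp : q ≤ p) (hu : frobSq (X u) ≤ p)
    (ha : ∀ s, s ≠ r → s ≠ u → frobSq (X s) ≤ q) :
    ∑ s, frobSq (mcomm (X r) (X s)) ≤
      frobSq (X r) * (∑ s, frobSq (X s) - frobSq (X r) + p + q) := by
  have hherm : ((-Complex.I) • X r).IsHermitian := by
    simp [Matrix.IsHermitian, conjTranspose_smul, hr]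
  obtain ⟨V, l, -, hV, hVl⟩ := hherm.exists_unitary_conj_eq_diagonal
  have hdiag : Vᴴ * X r * V = diagonal fun i => (l i : ℂ) * Complex.I := by
    have h := congrArg (fun M => Complex.I • M) hVl
    simp only [Matrix.mul_smul, Matrix.smul_mul, smul_smul, mul_neg, Complex.I_mul_I, neg_neg,
      one_smul, ← diagonal_smul] at h
    rw [h]
    congr 1
    ext i
    simp [mul_comm]
  have := sum_frobSq_mcomm_le_of_diagonal (fun s => Vᴴ * X s * V)
    (fun s t hst => by rw [trace_unitary_conj_mul hV, hX s t hst]) (r := r) (u := u) hdiag hq hqp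
    (by rwa [frobSq_unitary_conj hV]) (fun s => by rw [frobSq_unitary_conj hV]; exact ha s)
  simpa only [mcomm_unitary_conj hV, frobSq_unitary_conj hV] using this

/-- The inequality for families which are orthogonal for the Frobenius inner product. -/
theorem sum_frobSq_mcomm_le_of_orthogonal {n : ℕ} {ι : Type*} [Fintype ι] [DecidableEq ι]
    (hι : 3 ≤ Fintype.card ι) (X : ι → Matrix (Fin n) (Fin n) ℂ) (hskew : ∀ r, (X r)ᴴ = -X r)
    (hX : ∀ s t, s ≠ t → (X s * (X t)ᴴ).trace = 0) :
    ∑ r, ∑ s, frobSq (mcomm (X r) (X s)) ≤ 4 / 3 * (∑ r, frobSq (X r)) ^ 2 := by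
  set a : ι → ℝ := fun r => frobSq (X r) with ha
  have ha0 (r) : 0 ≤ a r := frobSq_nonneg _
  obtain ⟨x, -, hx⟩ := Finset.exists_max_image Finset.univ a
    (Finset.card_pos.1 (by rw [Finset.card_univ]; omega))
  have hcx : (Finset.univ.erase x).card = Fintype.card ι - 1 := by
    rw [Finset.card_erase_of_mem (Finset.mem_univ x), Finset.card_univ]
  obtain ⟨y, hyx, hy⟩ := Finset.exists_max_image (Finset.univ.erase x) a
    (Finset.card_pos.1 (by omega))
  obtain ⟨z, hzy, hz⟩ := Finset.exists_max_image ((Finset.univ.erase x).erase y) a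
    (Finset.card_pos.1 (by rw [Finset.card_erase_of_mem hyx]; omega))
  simp only [Finset.mem_univ, forall_const, Finset.mem_erase, and_true, ne_eq, and_imp]
    at hx hy hz hyx hzy
  set T := ∑ r, a r with hT
  have hbx : ∑ s, frobSq (mcomm (X x) (X s)) ≤ a x * (T - a x + a y + a z) :=
    sum_frobSq_mcomm_le X hX (hskew x) (ha0 z) (hy z hzy.2) le_rfl fun s h1 h2 => hz s h2 h1
  have hby : ∑ s, frobSq (mcomm (X y) (X s)) ≤ a y * (T - a y + a x + a z) :=
    sum_frobSq_mcomm_le X hX (hskew y) (ha0 z) (hx z) le_rfl fun s h1 h2 => hz s h1 h2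
  have hb (r) : ∑ s, frobSq (mcomm (X r) (X s)) ≤ a r * (T - a r + a x + a y) :=
    sum_frobSq_mcomm_le X hX (hskew r) (ha0 y) (hx y) le_rfl fun s _ h2 => hy s h2
  have hsplit (f : ι → ℝ) : ∑ r, f r =
      f x + (f y + (f z + ∑ r ∈ ((Finset.univ.erase x).erase y).erase z, f r)) := by
    rw [Finset.add_sum_erase _ _ (by simp [hzy]), Finset.add_sum_erase _ _ (by simp [hyx]),
      Finset.add_sum_erase _ _ (by simp)]
  have hrest : ∑ r ∈ ((Finset.univ.erase x).erase y).erase z, ∑ s, frobSq (mcomm (X r) (X s)) ≤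
      (T + a x + a y) * ∑ r ∈ ((Finset.univ.erase x).erase y).erase z, a r := by
    rw [Finset.mul_sum]
    refine Finset.sum_le_sum fun r _ => (hb r).trans ?_
    nlinarith [mul_self_nonneg (a r)]
  have hTs := hsplit a
  rw [← hT] at hTs
  rw [hsplit fun r => ∑ s, frobSq (mcomm (X r) (X s))]
  set R := ∑ r ∈ ((Finset.univ.erase x).erase y).erase z, a r
  have hbz := hb z
  have hR : R = T - a x - a y - a z := by linarith
  rw [hR] at hrest
  nlinarith [sq_nonneg (a x - a y), sq_nonneg (a z - (a x + a y) / 2),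
    sq_nonneg (a x + a y - 2 / 3 * T)]

section Rotation

variable {n : ℕ} {ι : Type*}

/-- The Gram matrix of a family of matrices for the real inner product `Re tr (A Bᴴ)`. -/
noncomputable def realGram (X : ι → Matrix (Fin n) (Fin n) ℂ) : Matrix ι ι ℝ :=
  of fun r s => ((X r * (X s)ᴴ).trace).re

theorem isHermitian_realGram (X : ι → Matrix (Fin n) (Fin n) ℂ) : (realGram X).IsHermitian := by
  ext r s
  have h : (X r * (X s)ᴴ)ᴴ = X s * (X r)ᴴ := by simp
  simp only [realGram, conjTranspose_apply, of_apply, star_trivial]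
  rw [← h, trace_conjTranspose, Complex.star_def, Complex.conj_re]

variable [Fintype ι]

/-- The family of linear combinations of `X` with coefficients the rows of `U`. -/
noncomputable def rotate (U : Matrix ι ι ℝ) (X : ι → Matrix (Fin n) (Fin n) ℂ) (r : ι) :
    Matrix (Fin n) (Fin n) ℂ :=
  ∑ s, (U r s : ℂ) • X s

theorem trace_realGram (X : ι → Matrix (Fin n) (Fin n) ℂ) :
    (realGram X).trace = ∑ r, frobSq (X r) := rfl

theorem realGram_rotate (U : Matrix ι ι ℝ) (X : ι → Matrix (Fin n) (Fin n) ℂ) :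
    realGram (rotate U X) = U * realGram X * Uᵀ := by
  ext r t
  simp only [realGram, rotate, of_apply, conjTranspose_sum, conjTranspose_smul,
    Finset.sum_mul_sum, smul_mul_smul_comm, trace_sum, trace_smul, Complex.re_sum,
    smul_eq_mul, Complex.star_def, Complex.conj_ofReal, ← Complex.ofReal_mul,
    Complex.re_ofReal_mul]
  simp only [Matrix.mul_apply, transpose_apply, of_apply, Finset.sum_mul]
  rw [Finset.sum_comm]
  exact Finset.sum_congr rfl fun i _ => Finset.sum_congr rfl fun j _ => by ring

theorem sum_frobSq_rotate [DecidableEq ι] {U : Matrix ι ι ℝ} (hU : Uᵀ * U = 1)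
    (X : ι → Matrix (Fin n) (Fin n) ℂ) :
    ∑ r, frobSq (rotate U X r) = ∑ r, frobSq (X r) := by
  rw [← trace_realGram, realGram_rotate, trace_mul_comm, ← Matrix.mul_assoc, hU, Matrix.one_mul,
    trace_realGram]

theorem mcomm_rotate (U : Matrix ι ι ℝ) (X : ι → Matrix (Fin n) (Fin n) ℂ) (r : ι)
    (C : Matrix (Fin n) (Fin n) ℂ) :
    mcomm (rotate U X r) C = rotate U (fun s => mcomm (X s) C) r := by
  simp only [mcomm, rotate, Finset.sum_mul, Finset.mul_sum, ← Finset.sum_sub_distrib, smul_sub,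
    Matrix.smul_mul, Matrix.mul_smul]

theorem sum_frobSq_mcomm_rotate [DecidableEq ι] {U : Matrix ι ι ℝ} (hU : Uᵀ * U = 1)
    (X : ι → Matrix (Fin n) (Fin n) ℂ) :
    ∑ r, ∑ s, frobSq (mcomm (rotate U X r) (rotate U X s)) =
      ∑ r, ∑ s, frobSq (mcomm (X r) (X s)) := by
  have h (C : Matrix (Fin n) (Fin n) ℂ) :
      ∑ r, frobSq (mcomm (rotate U X r) C) = ∑ r, frobSq (mcomm (X r) C) := by
    simp only [mcomm_rotate, sum_frobSq_rotate hU]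
  rw [Finset.sum_comm]
  simp only [h]
  rw [Finset.sum_comm]
  simp only [frobSq_mcomm_comm (X _) (rotate U X _), h]
  exact Finset.sum_comm

theorem conjTranspose_rotate (U : Matrix ι ι ℝ) {X : ι → Matrix (Fin n) (Fin n) ℂ}
    (hX : ∀ r, (X r)ᴴ = -X r) (r : ι) : (rotate U X r)ᴴ = -rotate U X r := by
  simp [rotate, conjTranspose_sum, conjTranspose_smul, hX]

end Rotation

theorem trace_mul_conjTranspose_eq_re {n : ℕ} {A B : Matrix (Fin n) (Fin n) ℂ}
    (hA : Aᴴ = -A) (hB : Bᴴ = -B) : (A * Bᴴ).trace = ((A * Bᴴ).trace.re : ℂ) := by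
  symm
  rw [← Complex.conj_eq_iff_re, starRingEnd_apply, ← trace_conjTranspose, conjTranspose_mul,
    conjTranspose_conjTranspose, hA, hB, Matrix.mul_neg, Matrix.mul_neg, trace_neg, trace_neg,
    trace_mul_comm]

theorem ddvv_skewHermitian (n m : ℕ) (hn : 1 ≤ n) (hm : 3 ≤ m)
    (B : Fin m → Matrix (Fin n) (Fin n) ℂ) (hB : ∀ r, (B r)ᴴ = -(B r)) :
    ∑ r : Fin m, ∑ s : Fin m, frobSq (mcomm (B r) (B s)) ≤
      (4 / 3) * (∑ r : Fin m, frobSq (B r)) ^ 2 := by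
  obtain ⟨V, l, -, hV, hVl⟩ := (isHermitian_realGram B).exists_unitary_conj_eq_diagonal
  have hU : (Vᵀ)ᵀ * Vᵀ = 1 := by
    rwa [transpose_transpose, ← conjTranspose_eq_transpose_of_trivial]
  rw [← sum_frobSq_mcomm_rotate hU, ← sum_frobSq_rotate hU B]
  have hskew := conjTranspose_rotate Vᵀ hB
  refine sum_frobSq_mcomm_le_of_orthogonal (by simpa using hm) _ hskew fun s t hst => ?_
  have hgram : realGram (rotate Vᵀ B) s t = 0 := by
    rw [realGram_rotate, transpose_transpose, ← conjTranspose_eq_transpose_of_trivial, hVl,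
      diagonal_apply_ne _ hst]
  rw [trace_mul_conjTranspose_eq_re (hskew s) (hskew t)]
  exact congrArg Complex.ofReal hgram
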